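/- arXiv:2411.16900 — 2 statements merged into one kernel-verified Lean document; each statement's English description precedes it below -/
import Mathlib

section
/- Let K be an algebraically closed field of characteristic 0. Then the additive group K/ℤ is isomorphic as an abstract group to the multiplicative group K^×. -/
universe u

open scoped nonZeroDivisors TensorProduct Cardinal

/-- A rational vector space of infinite dimension has cardinality equal to its dimension. -/
theorem Rat.rank_eq_mk_of_aleph0_le_rank {V : Type*} [AddCommGroup V] [Module ℚ V]
    (h : ℵ₀ ≤ Module.rank ℚ V) : Module.rank ℚ V = #V := by
  let b := Module.Basis.ofVectorSpace ℚ V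
  rw [← b.mk_eq_rank''] at h ⊢
  have : Infinite (Module.Basis.ofVectorSpaceIndex ℚ V) := Cardinal.infinite_iff.mpr h
  rw [b.repr.toEquiv.cardinal_eq, Cardinal.mk_finsupp_lift_of_infinite]
  simp [Cardinal.aleph0_le_mk]

theorem rank_rat_tensorProduct (M : Type*) [AddCommGroup M] :
    Module.rank ℚ (ℚ ⊗[ℤ] M) = Module.rank ℤ M := by
  refine (IsLocalization.rank_eq ℚ ℤ⁰ le_rfl).trans ?_
  convert IsLocalizedModule.rank_eq ℤ⁰ le_rfl (TensorProduct.mk ℤ ℚ M 1)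
  exact Subsingleton.elim _ _

theorem rat_tensorProduct_mk_surjective (M : Type*) [AddCommGroup M] [DivisibleBy M ℤ] :
    Function.Surjective (TensorProduct.mk ℤ ℚ M 1) := by
  intro y
  obtain ⟨⟨x, s⟩, hs⟩ := IsLocalizedModule.surj ℤ⁰ (TensorProduct.mk ℤ ℚ M 1) y
  have hs0 : (s : ℤ) ≠ 0 := nonZeroDivisors.coe_ne_zero s
  refine ⟨DivisibleBy.div x (s : ℤ), ?_⟩
  apply IsLocalizedModule.smul_injective (TensorProduct.mk ℤ ℚ M 1) s
  simp only [hs, Submonoid.smul_def, ← map_smul, DivisibleBy.div_cancel x hs0]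

/-- Every element of `ℚ/ℤ` is torsion. -/
theorem AddCircle.exists_zsmul_eq_zero (t : AddCircle (1 : ℚ)) : ∃ n : ℤ, n ≠ 0 ∧ n • t = 0 := by
  obtain ⟨q, rfl⟩ := QuotientAddGroup.mk_surjective t
  refine ⟨q.den, by simp, ?_⟩
  refine (QuotientAddGroup.eq_zero_iff _).mpr (AddSubgroup.mem_zmultiples_iff.mpr ⟨q.num, ?_⟩)
  simp [Rat.den_mul_eq_num]

/-- A divisible group whose torsion is a copy of `ℚ/ℤ` splits as the product of `ℚ/ℤ` and its
rationalization. -/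
theorem nonempty_addEquiv_addCircle_prod {M : Type*} [AddCommGroup M] [DivisibleBy M ℤ]
    (j : AddCircle (1 : ℚ) →+ M) (hj : Function.Injective j)
    (htors : ∀ (n : ℤ) (m : M), n ≠ 0 → n • m = 0 → m ∈ j.range) :
    Nonempty (M ≃+ AddCircle (1 : ℚ) × (ℚ ⊗[ℤ] M)) := by
  obtain ⟨r, hr⟩ := (Module.Baer.of_divisible (AddCircle (1 : ℚ))).extension_property_addMonoidHom
    j hj (AddMonoidHom.id _)
  replace hr (t) : r (j t) = t := DFunLike.congr_fun hr t
  let π := TensorProduct.mk ℤ ℚ M 1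
  have hπ (t) : π (j t) = 0 := by
    obtain ⟨n, hn, h⟩ := AddCircle.exists_zsmul_eq_zero t
    refine (IsLocalizedModule.eq_zero_iff ℤ⁰ π).mpr ⟨⟨n, mem_nonZeroDivisors_of_ne_zero hn⟩, ?_⟩
    rw [Submonoid.mk_smul, ← map_zsmul, h, map_zero]
  refine ⟨AddEquiv.ofBijective (r.prod π.toAddMonoidHom) ⟨?_, ?_⟩⟩
  · rw [injective_iff_map_eq_zero]
    intro m hm
    obtain ⟨h1, h2⟩ := Prod.mk_eq_zero.mp hm
    obtain ⟨s, hs⟩ := (IsLocalizedModule.eq_zero_iff ℤ⁰ π).mp h2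
    obtain ⟨t, rfl⟩ := htors s m (nonZeroDivisors.coe_ne_zero s) hs
    rw [← hr t, h1, map_zero]
  · rintro ⟨t, v⟩
    obtain ⟨m, rfl⟩ := rat_tensorProduct_mk_surjective M v
    refine ⟨m + j (t - r m), Prod.ext ?_ ?_⟩
    · simp [hr]
    · exact (map_add π _ _).trans (by rw [hπ, add_zero])

/-- Divisible groups whose torsion is a copy of `ℚ/ℤ` are classified by their rank. -/
theorem nonempty_addEquiv_of_rank_eq {M N : Type u} [AddCommGroup M] [DivisibleBy M ℤ]
    [AddCommGroup N] [DivisibleBy N ℤ]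
    (j : AddCircle (1 : ℚ) →+ M) (hj : Function.Injective j)
    (htors : ∀ (n : ℤ) (m : M), n ≠ 0 → n • m = 0 → m ∈ j.range)
    (j' : AddCircle (1 : ℚ) →+ N) (hj' : Function.Injective j')
    (htors' : ∀ (n : ℤ) (m : N), n ≠ 0 → n • m = 0 → m ∈ j'.range)
    (hrank : Module.rank ℤ M = Module.rank ℤ N) :
    Nonempty (M ≃+ N) := by
  obtain ⟨e⟩ := nonempty_addEquiv_addCircle_prod j hj htors
  obtain ⟨e'⟩ := nonempty_addEquiv_addCircle_prod j' hj' htors'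
  rw [← rank_rat_tensorProduct M, ← rank_rat_tensorProduct N] at hrank
  obtain ⟨f⟩ := nonempty_linearEquiv_of_rank_eq hrank
  exact ⟨e.trans (((AddEquiv.refl _).prodCongr f.toAddEquiv).trans e'.symm)⟩

/-- A divisible group of infinite rank whose torsion is a copy of `ℚ/ℤ` has cardinality equal to
its rank. -/
theorem rank_int_eq_mk_of_addCircle {M : Type*} [AddCommGroup M] [DivisibleBy M ℤ]
    (j : AddCircle (1 : ℚ) →+ M) (hj : Function.Injective j)
    (htors : ∀ (n : ℤ) (m : M), n ≠ 0 → n • m = 0 → m ∈ j.range)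
    (h : ℵ₀ ≤ Module.rank ℤ M) : Module.rank ℤ M = #M := by
  obtain ⟨e⟩ := nonempty_addEquiv_addCircle_prod j hj htors
  rw [← rank_rat_tensorProduct] at h ⊢
  have hV := Rat.rank_eq_mk_of_aleph0_le_rank h
  have hT : #(AddCircle (1 : ℚ)) ≤ ℵ₀ :=
    (Cardinal.mk_le_of_surjective QuotientAddGroup.mk_surjective).trans Cardinal.mk_le_aleph0
  rw [hV] at h ⊢
  rw [e.toEquiv.cardinal_eq, Cardinal.mk_prod, Cardinal.mul_eq_right] <;> simp
  · exact h
  · exact (Cardinal.lift_le_aleph0.mpr hT).trans h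

/-- The map `q ↦ exp (2πiq)`, transported from the algebraic numbers to any algebraically closed
field of characteristic zero. -/
theorem exists_addMonoidHom_rat_units (K : Type*) [Field K] [IsAlgClosed K] [CharZero K] :
    ∃ g : ℚ →+ Additive Kˣ, g.ker = AddSubgroup.zmultiples (1 : ℚ) := by
  let A := algebraicClosure ℚ ℂ
  have : Algebra.IsAlgebraic ℚ A := algebraicClosure.isAlgebraic ℚ ℂ
  let φ : A →ₐ[ℚ] K := IsAlgClosed.lift
  let E (q : ℚ) : ℂ := Complex.exp (q * (2 * Real.pi * Complex.I))
  have hE (q : ℚ) : E q ∈ A := by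
    rw [mem_algebraicClosure_iff]
    have hpow : E q ^ q.den = 1 := by
      rw [← Complex.exp_nat_mul, Complex.exp_eq_one_iff]
      refine ⟨q.num, ?_⟩
      rw [← mul_assoc]
      congr 1
      exact_mod_cast q.den_mul_eq_num
    exact (IsIntegral.of_pow q.den_pos (hpow ▸ isIntegral_one)).isAlgebraic
  let e : Multiplicative ℚ →* A :=
    { toFun q := ⟨E q.toAdd, hE _⟩
      map_one' := by
        ext
        simp [E]
      map_mul' a b := by
        ext
        simp [E, add_mul, Complex.exp_add] }
  refine ⟨MonoidHom.toAdditiveRight ((φ : A →* K).comp e).toHomUnits, ?_⟩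
  ext q
  have h1 : φ (e (.ofAdd q)) = 1 ↔ E q = 1 := by
    rw [map_eq_one_iff φ φ.injective]
    exact Subtype.ext_iff
  have h2 : E q = 1 ↔ ∃ n : ℤ, (n : ℚ) = q := by
    rw [Complex.exp_eq_one_iff]
    refine exists_congr fun n ↦ ?_
    rw [mul_left_inj' Complex.two_pi_I_ne_zero, eq_comm]
    norm_cast
  rw [AddMonoidHom.mem_ker, AddSubgroup.mem_zmultiples_iff]
  simp only [zsmul_one]
  rw [← h2, ← h1]
  exact Units.ext_iff

/-- The prime numbers are multiplicatively independent in a field of characteristic zero. -/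
theorem linearIndependent_primes (K : Type*) [Field K] [CharZero K] :
    LinearIndependent ℤ fun p : Nat.Primes ↦
      Additive.ofMul (Units.mk0 ((p : ℕ) : K) (by exact_mod_cast p.2.ne_zero)) := by
  let v (p : Nat.Primes) : Additive ℚˣ :=
    .ofMul (Units.mk0 ((p : ℕ) : ℚ) (by exact_mod_cast p.2.ne_zero))
  let ℓ (p : Nat.Primes) : Additive ℚˣ →+ ℤ :=
    { toFun q := padicValRat p (q.toMul : ℚ)
      map_zero' := by simp
      map_add' a b := by
        have := Fact.mk p.2
        exact padicValRat.mul a.toMul.ne_zero b.toMul.ne_zero }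
  have hℓ (p q) : ℓ p (v q) = if q = p then 1 else 0 := by
    have := Fact.mk p.2
    have := Fact.mk q.2
    change padicValRat p ((q : ℕ) : ℚ) = _
    rw [padicValRat.of_nat]
    split_ifs with h
    · simp [h]
    · rw [padicValNat_primes fun h' ↦ h (Subtype.ext h'.symm), Nat.cast_zero]
  have hv : LinearIndependent ℤ v := by
    rw [linearIndependent_iff']
    intro s c hc p hp
    have := congrArg (ℓ p) hc
    simpa [hℓ, hp] using this
  let ι := (Units.map (algebraMap ℚ K : ℚ →* K)).toAdditive
  have hι : Function.Injective ι := Units.map_injective (algebraMap ℚ K).injective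
  convert hv.map_injOn ι.toIntLinearMap hι.injOn using 1
  · funext p
    apply Additive.toMul.injective
    ext
    simp [v, ι]
  · rfl

theorem aleph0_le_rank_rat (K : Type*) [Field K] [IsAlgClosed K] [CharZero K] :
    ℵ₀ ≤ Module.rank ℚ K := by
  by_contra! h
  have : Module.Finite ℚ K := Module.rank_lt_aleph0_iff.mp h
  obtain ⟨p, hp, hprime⟩ := Nat.exists_infinite_primes (Module.finrank ℚ K + 2)
  have : NeZero (p : K) := ⟨by exact_mod_cast hprime.ne_zero⟩
  obtain ⟨ζ, hζ⟩ := HasEnoughRootsOfUnity.exists_primitiveRoot K p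
  have h1 := minpoly.natDegree_le (A := ℚ) ζ
  rw [← Polynomial.cyclotomic_eq_minpoly_rat hζ hprime.pos, Polynomial.natDegree_cyclotomic,
    Nat.totient_prime hprime] at h1
  omega

theorem aleph0_le_rank_units (K : Type*) [Field K] [CharZero K] :
    ℵ₀ ≤ Module.rank ℤ (Additive Kˣ) := by
  simpa using (linearIndependent_primes K).cardinal_lift_le_rank

theorem mk_additive_units (K : Type*) [Field K] [Infinite K] : #(Additive Kˣ) = #K := by
  rw [Additive.ofMul.symm.cardinal_eq, unitsEquivNeZero.cardinal_eq]
  exact Cardinal.mk_compl_of_infinite {(0 : K)}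
    (by simpa using Cardinal.one_lt_aleph0.trans_le (Cardinal.aleph0_le_mk K))

theorem rank_int_quotient_zmultiples_one (K : Type*) [Field K] [IsAlgClosed K] [CharZero K] :
    Module.rank ℤ (K ⧸ AddSubgroup.zmultiples (1 : K)) = #K := by
  have hK := aleph0_le_rank_rat K
  have hKc := Rat.rank_eq_mk_of_aleph0_le_rank hK
  have hKz : Module.rank ℚ K = Module.rank ℤ K := IsLocalization.rank_eq ℚ ℤ⁰ le_rfl
  let π := (QuotientAddGroup.mk' (AddSubgroup.zmultiples (1 : K))).toIntLinearMap
  have h := LinearMap.rank_eq_of_surjective (f := π) QuotientAddGroup.mk_surjective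
  have hker : Module.rank ℤ π.ker ≤ 1 := by
    have : π.ker = Submodule.span ℤ {1} := by
      ext x
      rw [LinearMap.mem_ker, Submodule.mem_span_singleton, ← AddSubgroup.mem_zmultiples_iff]
      exact QuotientAddGroup.eq_zero_iff x
    rw [this]
    simpa using rank_span_le (R := ℤ) {(1 : K)}
  rw [← hKz, hKc] at h
  rw [hKc] at hK
  rw [h] at hK ⊢
  rcases le_or_gt ℵ₀ (Module.rank ℤ (K ⧸ AddSubgroup.zmultiples (1 : K))) with hq | hq
  · rw [Cardinal.add_eq_left hq (hker.trans (Cardinal.one_le_aleph0.trans hq))]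
  · exact absurd (Cardinal.add_lt_aleph0 hq (hker.trans_lt Cardinal.one_lt_aleph0)) hK.not_gt

/-- The torsion of `Kˣ` is a copy of `ℚ/ℤ`. -/
theorem exists_addCircle_units (K : Type*) [Field K] [IsAlgClosed K] [CharZero K] :
    ∃ j : AddCircle (1 : ℚ) →+ Additive Kˣ, Function.Injective j ∧
      ∀ (n : ℤ) (m : Additive Kˣ), n ≠ 0 → n • m = 0 → m ∈ j.range := by
  obtain ⟨g, hg⟩ := exists_addMonoidHom_rat_units K
  have hg0 (q : ℚ) : (g q).toMul = 1 ↔ ∃ n : ℤ, (n : ℚ) = q := by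
    have := AddMonoidHom.mem_ker (f := g) (x := q)
    rw [hg, AddSubgroup.mem_zmultiples_iff] at this
    simpa using this.symm
  refine ⟨QuotientAddGroup.lift _ g hg.ge, ?_, ?_⟩
  · rw [injective_iff_map_eq_zero]
    intro t ht
    obtain ⟨q, rfl⟩ := QuotientAddGroup.mk_surjective t
    exact (QuotientAddGroup.eq_zero_iff q).mpr (hg ▸ ht)
  · intro n m hn hm
    have hN : n.natAbs ≠ 0 := Int.natAbs_ne_zero.mpr hn
    have hm' : m.toMul ^ n.natAbs = 1 := by
      rw [pow_natAbs_eq_one]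
      exact hm
    clear hn hm
    generalize n.natAbs = N at hN hm'
    have : NeZero N := ⟨hN⟩
    have hζ : IsPrimitiveRoot (g (N : ℚ)⁻¹).toMul N := by
      have key (k : ℕ) : (g (N : ℚ)⁻¹).toMul ^ k = 1 ↔ N ∣ k := by
        rw [← toMul_nsmul, ← map_nsmul, hg0, ← Int.natCast_dvd_natCast]
        refine exists_congr fun a ↦ ?_
        rw [nsmul_eq_mul, eq_mul_inv_iff_mul_eq₀ (by exact_mod_cast hN), eq_comm, mul_comm]
        norm_cast
      exact ⟨(key _).mpr dvd_rfl, fun k hk ↦ (key k).mp hk⟩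
    obtain ⟨i, -, hi⟩ := (IsPrimitiveRoot.coe_units_iff.mpr hζ).eq_pow_of_pow_eq_one
      (ξ := (m.toMul : K)) (by rw [← Units.val_pow_eq_pow_val, hm', Units.val_one])
    refine ⟨((i • (N : ℚ)⁻¹ : ℚ) : AddCircle (1 : ℚ)), ?_⟩
    apply Additive.toMul.injective
    ext
    rw [← hi]
    exact congrArg (fun x : Additive Kˣ ↦ (x.toMul : K)) (map_nsmul g i _)

/-- The torsion of `K/ℤ` is a copy of `ℚ/ℤ`. -/
theorem exists_addCircle_quotient_zmultiples_one (K : Type*) [Field K] [CharZero K] :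
    ∃ j : AddCircle (1 : ℚ) →+ K ⧸ AddSubgroup.zmultiples (1 : K), Function.Injective j ∧
      ∀ (n : ℤ) (m : K ⧸ AddSubgroup.zmultiples (1 : K)), n ≠ 0 → n • m = 0 → m ∈ j.range := by
  let g : ℚ →+ K := (algebraMap ℚ K).toAddMonoidHom
  have hg (q : ℚ) : g q ∈ AddSubgroup.zmultiples (1 : K) ↔
      q ∈ AddSubgroup.zmultiples (1 : ℚ) := by
    simp only [AddSubgroup.mem_zmultiples_iff, zsmul_one]
    refine exists_congr fun n ↦ ?_
    change (n : K) = algebraMap ℚ K q ↔ _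
    rw [eq_ratCast]
    norm_cast
  refine ⟨QuotientAddGroup.map _ _ g fun q hq ↦ (hg q).mpr hq, ?_, ?_⟩
  · rw [injective_iff_map_eq_zero]
    intro t ht
    obtain ⟨q, rfl⟩ := QuotientAddGroup.mk_surjective t
    exact (QuotientAddGroup.eq_zero_iff q).mpr ((hg q).mp ((QuotientAddGroup.eq_zero_iff _).mp ht))
  · intro n m hn hm
    obtain ⟨x, rfl⟩ := QuotientAddGroup.mk_surjective m
    obtain ⟨k, hk⟩ := AddSubgroup.mem_zmultiples_iff.mp <|
      (QuotientAddGroup.eq_zero_iff (n • x)).mp hm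
    refine ⟨((k / n : ℚ) : AddCircle (1 : ℚ)), congrArg QuotientAddGroup.mk ?_⟩
    change algebraMap ℚ K (k / n) = x
    have hn' : (n : K) ≠ 0 := by exact_mod_cast hn
    simp only [zsmul_eq_mul, mul_one] at hk
    simp [hk, hn']

/-- Let `K` be an algebraically closed field of characteristic `0`. Then the additive
group `K/ℤ` is isomorphic, as an abstract group, to the multiplicative group `Kˣ`. -/
theorem stmt_1 (K : Type*) [Field K] [IsAlgClosed K] [CharZero K] :
    Nonempty (Multiplicative (K ⧸ AddSubgroup.zmultiples (1 : K)) ≃* Kˣ) := by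
  let : DivisibleBy (K ⧸ AddSubgroup.zmultiples (1 : K)) ℤ :=
    QuotientAddGroup.mk_surjective.divisibleBy _ fun _ _ ↦ rfl
  let : DivisibleBy (Additive Kˣ) ℤ :=
    have : DivisibleBy (Additive Kˣ) ℕ := divisibleByOfSMulRightSurj _ _ fun {n} hn u ↦ by
      obtain ⟨z, hz⟩ := IsAlgClosed.exists_pow_nat_eq (u.toMul : K) (Nat.pos_of_ne_zero hn)
      have hz0 : z ≠ 0 := by
        rintro rfl
        exact u.toMul.ne_zero (by rw [← hz, zero_pow hn])
      refine ⟨.ofMul (Units.mk0 z hz0), Additive.toMul.injective (Units.ext ?_)⟩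
      simpa using hz
    AddGroup.divisibleByIntOfDivisibleByNat _
  obtain ⟨j, hj, htors⟩ := exists_addCircle_quotient_zmultiples_one K
  obtain ⟨j', hj', htors'⟩ := exists_addCircle_units K
  obtain ⟨e⟩ := nonempty_addEquiv_of_rank_eq j hj htors j' hj' htors' <| by
    rw [rank_int_quotient_zmultiples_one, rank_int_eq_mk_of_addCircle j' hj' htors'
      (aleph0_le_rank_units K), mk_additive_units]
  exact ⟨AddEquiv.toMultiplicativeLeft e⟩
end

section
/- The differential ring A is a differential K-algebra without exponents nor logarithm (i.e. A^{∂²=0} = K and A^{∂+a=0} = 0 for all a in a fixed set of representatives of (K/ℤ)∖{0}) if and only if A^{∂=0} = A[t^K]^{∂=0} = E_A^{∂=0} = K. -/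
open scoped TensorProduct
open Polynomial

noncomputable section

/-- `K[t,t⁻¹] → K[t^K]`: the inclusion of the Laurent polynomials (the group algebra
of `ℤ`) into the group algebra `K⟨K⟩ = K[t^K]` of the additive group `(K,+)`. -/
instance instLaurentToGrpAlg (K : Type) [Field K] :
    Algebra (LaurentPolynomial K) (AddMonoidAlgebra K K) :=
  (AddMonoidAlgebra.mapDomainRingHom K (Int.castAddHom K)).toAlgebra

variable (K : Type) [Field K] [IsAlgClosed K] [CharZero K]
variable (A : Type) [CommRing A] [Algebra K A] [Algebra (LaurentPolynomial K) A]
  [IsScalarTower K (LaurentPolynomial K) A]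

/-- `A[t^K] := A ⊗_{K[t,t⁻¹]} K[t^K]`. -/
abbrev AtK := A ⊗[LaurentPolynomial K] (AddMonoidAlgebra K K)

/-- The ring of exponents `E_A := A[t^K][ℓ]`. -/
abbrev EA := Polynomial (AtK K A)

/-- The canonical inclusion `A → E_A`. -/
def iA : A →+* EA K A :=
  (Polynomial.C).comp (Algebra.TensorProduct.includeLeftRingHom)

/-- The element `t^a ∈ A[t^K] ⊆ E_A`, for `a ∈ K`. -/
def tpow (a : K) : EA K A :=
  Polynomial.C ((1:A) ⊗ₜ[LaurentPolynomial K] (AddMonoidAlgebra.single a 1))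

/-- `t ∈ A`, the image of the Laurent variable. -/
def tA : A := algebraMap (LaurentPolynomial K) A (LaurentPolynomial.T 1)

variable {K A}

/-- `∂ : A → A` is a derivation extending `t·d/dt` on `K[t,t⁻¹]`: it kills the
constants `K` and sends `t` to `t`. -/
def ExtendsTddt (dA : Derivation ℤ A A) : Prop :=
  (∀ c : K, dA (algebraMap K A c) = 0) ∧ dA (tA K A) = tA K A

/-- The characterizing properties of the derivation `∂` on `E_A`: it extends the
derivation `∂` of `A`, satisfies `∂(t^a) = a·t^a` for all `a ∈ K`, and `∂(ℓ) = 1`. -/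
def DProps (dA : Derivation ℤ A A) (D : Derivation ℤ (EA K A) (EA K A)) : Prop :=
  (∀ x : A, D (iA K A x) = iA K A (dA x)) ∧
  (∀ a : K, D (tpow K A a) = a • tpow K A a) ∧
  D (Polynomial.X : EA K A) = 1

/-- `γ : K → Kˣ` is a group homomorphism from `(K,+)` to `Kˣ` with kernel exactly
`ℤ` (induced by a choice of isomorphism `K/ℤ ≅ Kˣ`). -/
def GammaProps (γ : K → Kˣ) : Prop :=
  (∀ a b : K, γ (a + b) = γ a * γ b) ∧ (∀ a : K, γ a = 1 ↔ ∃ n : ℤ, (n : K) = a)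

/-- The characterizing properties of the monodromy automorphism `σ` of `E_A`:
it fixes `A` pointwise, `σ(t^a) = γ(a)·t^a`, and `σ(ℓ) = ℓ + 1`. -/
def SProps (γ : K → Kˣ) (σ : EA K A ≃+* EA K A) : Prop :=
  (∀ x : A, σ (iA K A x) = iA K A x) ∧
  (∀ a : K, σ (tpow K A a) = ((γ a : K) • tpow K A a)) ∧
  σ (Polynomial.X : EA K A) = Polynomial.X + 1

/-- `A` is a differential `K`-algebra without exponents nor logarithm:
`A^{∂²=0} = K` and `A^{∂+a=0} = 0` for every `a ∈ K` not in `ℤ`. -/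
def NoExpLog (dA : Derivation ℤ A A) : Prop :=
  (∀ x : A, dA (dA x) = 0 ↔ ∃ c : K, x = algebraMap K A c) ∧
  (∀ a : K, (¬ ∃ n : ℤ, (n : K) = a) → ∀ x : A, dA x + a • x = 0 → x = 0)


/-- A set-theoretic section of `K → K/ℤ` sending `0` to `0`. -/
def exponentRep (K : Type) [Field K] (q : K ⧸ (Int.castAddHom K).range) : K :=
  open Classical in if q = 0 then 0 else q.out

lemma exponentRep_zero (K : Type) [Field K] : exponentRep K 0 = 0 := if_pos rfl

lemma mk_exponentRep {K : Type} [Field K] (q : K ⧸ (Int.castAddHom K).range) :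
    (exponentRep K q : K ⧸ (Int.castAddHom K).range) = q := by
  unfold exponentRep
  split_ifs with h
  · rw [h]; rfl
  · exact Quotient.out_eq' q

lemma mk_eq_zero_iff_exists_int {K : Type} [Field K] (a : K) :
    (a : K ⧸ (Int.castAddHom K).range) = 0 ↔ ∃ n : ℤ, (n : K) = a := by
  rw [QuotientAddGroup.eq_zero_iff]; rfl

lemma laurent_algebraMap_single {K : Type} [Field K] (n : ℤ) (k : K) :
    algebraMap (LaurentPolynomial K) (AddMonoidAlgebra K K) (AddMonoidAlgebra.single n k) =
      AddMonoidAlgebra.single (n : K) k :=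
  AddMonoidAlgebra.mapDomain_single

lemma coeff_laurent_smul_exponentRep {K : Type} [Field K] [CharZero K]
    (p : LaurentPolynomial K)
    (q q' : K ⧸ (Int.castAddHom K).range) (n : ℤ) :
    (p • (AddMonoidAlgebra.single (exponentRep K q) 1 : AddMonoidAlgebra K K)).coeff
      (n + exponentRep K q') = open Classical in if q = q' then p.coeff n else 0 := by
  classical
  induction p using AddMonoidAlgebra.induction_linear with
  | zero => simp
  | add f g hf hg =>
    rw [add_smul, AddMonoidAlgebra.coeff_add, Finsupp.add_apply, hf, hg]
    split_ifs <;> simp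
  | single m k =>
    rw [Algebra.smul_def, laurent_algebraMap_single, AddMonoidAlgebra.single_mul_single,
      AddMonoidAlgebra.coeff_single, AddMonoidAlgebra.coeff_single, mul_one,
      Finsupp.single_apply, Finsupp.single_apply]
    by_cases h : q = q'
    · subst h
      simp
    · rw [if_neg h, if_neg]
      intro e
      apply h
      rw [← mk_exponentRep q, ← mk_exponentRep q', QuotientAddGroup.eq]
      refine ⟨m - n, ?_⟩
      simp only [Int.coe_castAddHom, Int.cast_sub]
      linear_combination e

lemma linearIndependent_exponentRep (K : Type) [Field K] [CharZero K] :
    LinearIndependent (LaurentPolynomial K) fun q : K ⧸ (Int.castAddHom K).range ↦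
      (AddMonoidAlgebra.single (exponentRep K q) 1 : AddMonoidAlgebra K K) := by
  classical
  rw [linearIndependent_iff]
  intro f hf
  ext q n
  have h := congrArg (fun x ↦ x.coeff (n + exponentRep K q)) hf
  simp only [Finsupp.linearCombination_apply, AddMonoidAlgebra.coeff_finsuppSum,
    Finsupp.sum_apply, coeff_laurent_smul_exponentRep] at h
  simp only [Finsupp.sum, Finset.sum_ite_eq', AddMonoidAlgebra.coeff_zero, Finsupp.zero_apply,
    ite_eq_right_iff, Finsupp.mem_support_iff] at h
  by_cases h0 : f q = 0
  · simp [h0]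
  · exact h h0

lemma exists_single_eq_smul_exponentRep {K : Type} [Field K] (b : K) : ∃ n : ℤ, ∀ k : K,
    (AddMonoidAlgebra.single b k : AddMonoidAlgebra K K) =
      (AddMonoidAlgebra.single n k : LaurentPolynomial K) •
        AddMonoidAlgebra.single (exponentRep K b) 1 := by
  obtain ⟨n, hn⟩ := QuotientAddGroup.eq.mp (mk_exponentRep (K := K) b)
  refine ⟨n, fun k ↦ ?_⟩
  rw [Algebra.smul_def, laurent_algebraMap_single, AddMonoidAlgebra.single_mul_single, mul_one]
  congr 1
  simp only [Int.coe_castAddHom] at hn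
  linear_combination -hn

lemma span_exponentRep (K : Type) [Field K] :
    ⊤ ≤ Submodule.span (LaurentPolynomial K)
      (Set.range fun q : K ⧸ (Int.castAddHom K).range ↦
        (AddMonoidAlgebra.single (exponentRep K q) 1 : AddMonoidAlgebra K K)) := by
  rintro x -
  induction x using AddMonoidAlgebra.induction_linear with
  | zero => exact zero_mem _
  | add f g hf hg => exact add_mem hf hg
  | single b k =>
    obtain ⟨n, hn⟩ := exists_single_eq_smul_exponentRep b
    rw [hn]
    exact Submodule.smul_mem _ _ (Submodule.subset_span ⟨_, rfl⟩)

/-- The basis of `A[t^K]` over `A` given by the powers `t^a`, with `a` running over the chosen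
representatives of `K/ℤ`. -/
def powBasis (K : Type) [Field K] [CharZero K] (A : Type) [CommRing A]
    [Algebra (LaurentPolynomial K) A] :
    Module.Basis (K ⧸ (Int.castAddHom K).range) A (AtK K A) :=
  Algebra.TensorProduct.basis A
    (Module.Basis.mk (linearIndependent_exponentRep K) (span_exponentRep K))

section Coordinates

variable {K : Type} [Field K] {A : Type} [CommRing A] [Algebra (LaurentPolynomial K) A]

lemma powBasis_apply [CharZero K] (q : K ⧸ (Int.castAddHom K).range) :
    powBasis K A q =
      (1 : A) ⊗ₜ[LaurentPolynomial K] AddMonoidAlgebra.single (exponentRep K q) 1 := by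
  simp [powBasis]

lemma smul_one_eq_includeLeft (x : A) :
    x • (1 : AtK K A) = Algebra.TensorProduct.includeLeftRingHom x := by
  change x • ((1 : A) ⊗ₜ[LaurentPolynomial K] (1 : AddMonoidAlgebra K K)) = x ⊗ₜ 1
  rw [TensorProduct.smul_tmul', smul_eq_mul, mul_one]

lemma powBasis_zero [CharZero K] : powBasis K A 0 = 1 := by
  rw [powBasis_apply, exponentRep_zero]; rfl

lemma repr_includeLeft [CharZero K] (x : A) :
    (powBasis K A).repr (Algebra.TensorProduct.includeLeftRingHom x) = Finsupp.single 0 x := by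
  rw [← smul_one_eq_includeLeft, ← powBasis_zero (K := K) (A := A)]
  simp

lemma includeLeft_injective [CharZero K] : Function.Injective
    (Algebra.TensorProduct.includeLeftRingHom : A →+* AtK K A) := fun x y h ↦
  Finsupp.single_injective (0 : K ⧸ (Int.castAddHom K).range)
    (by rw [← repr_includeLeft, h, repr_includeLeft])

lemma C_powBasis [CharZero K] (q : K ⧸ (Int.castAddHom K).range) :
    (C (powBasis K A q) : EA K A) = tpow K A (exponentRep K q) := by
  rw [powBasis_apply]; rfl

lemma C_smul (x : A) (y : AtK K A) : (C (x • y) : EA K A) = iA K A x * C y := by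
  rw [← one_mul y, ← smul_mul_assoc, smul_one_eq_includeLeft, C_mul, one_mul]; rfl

lemma iA_injective [CharZero K] : Function.Injective (iA K A) :=
  C_injective.comp includeLeft_injective

lemma tmul_single_eq_smul_powBasis [CharZero K] (x : A) (a : K) : ∃ u : A, IsUnit u ∧
    x ⊗ₜ[LaurentPolynomial K] (AddMonoidAlgebra.single a 1 : AddMonoidAlgebra K K) =
      (u * x) • powBasis K A a := by
  obtain ⟨n, hn⟩ := exists_single_eq_smul_exponentRep a
  refine ⟨algebraMap (LaurentPolynomial K) A (LaurentPolynomial.T n),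
    (LaurentPolynomial.isUnit_T n).map _, ?_⟩
  rw [hn, powBasis_apply, TensorProduct.smul_tmul', ← TensorProduct.smul_tmul, smul_eq_mul,
    mul_one, Algebra.smul_def]
  rfl

variable [Algebra K A] [IsScalarTower K (LaurentPolynomial K) A]

lemma algebraMap_AtK (c : K) : algebraMap K (AtK K A) c =
    Algebra.TensorProduct.includeLeftRingHom (algebraMap K A c) := rfl

lemma algebraMap_EA (c : K) : algebraMap K (EA K A) c = iA K A (algebraMap K A c) := rfl

lemma exists_derivation_C [CharZero K] {dA : Derivation ℤ A A}
    {D : Derivation ℤ (EA K A) (EA K A)} (hD : DProps (K := K) dA D) (x : AtK K A) :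
    ∃ y : AtK K A, D (C x) = C y ∧
      ∀ q, (powBasis K A).repr y q =
        dA ((powBasis K A).repr x q) + exponentRep K q • (powBasis K A).repr x q := by
  rw [← (powBasis K A).linearCombination_repr x]
  induction (powBasis K A).repr x using Finsupp.induction_linear with
  | zero => exact ⟨0, by simp, by simp⟩
  | add f g hf hg =>
    obtain ⟨y, hy, hy'⟩ := hf
    obtain ⟨z, hz, hz'⟩ := hg
    refine ⟨y + z, by rw [map_add, C_add, map_add, hy, hz, C_add], fun q ↦ ?_⟩
    simp only [map_add, Finsupp.add_apply, hy', hz', smul_add]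
    abel
  | single p a =>
    refine ⟨(dA a + exponentRep K p • a) • powBasis K A p, ?_, fun q ↦ ?_⟩
    · rw [Finsupp.linearCombination_single, C_smul, C_smul, Derivation.leibniz, hD.1, C_powBasis,
        hD.2.1, Algebra.smul_def (exponentRep K p) (tpow K A _), algebraMap_EA,
        Algebra.smul_def (exponentRep K p) a, map_add, map_mul]
      simp only [smul_eq_mul]
      ring
    · classical
      simp only [Finsupp.linearCombination_single, map_smul, Module.Basis.repr_self,
        Finsupp.smul_single, smul_eq_mul, mul_one, Finsupp.single_apply]
      split_ifs with h
      · rw [h]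
      · simp

lemma coeff_derivation [CharZero K] {dA : Derivation ℤ A A}
    {D : Derivation ℤ (EA K A) (EA K A)} (hD : DProps (K := K) dA D) (p : EA K A) (n : ℕ) :
    C ((D p).coeff n) = D (C (p.coeff n)) + C (((n : AtK K A) + 1) * p.coeff (n + 1)) := by
  induction p using Polynomial.induction_on' with
  | add p q hp hq =>
    simp only [map_add, coeff_add, mul_add, hp, hq]
    abel
  | monomial m a =>
    obtain ⟨y, hy, -⟩ := exists_derivation_C hD a
    have h_mon : D (monomial m a) = derivative (monomial m a) + C y * X ^ m := by
      rw [← C_mul_X_pow_eq_monomial, Derivation.leibniz, Derivation.leibniz_pow, hD.2.2, hy,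
        derivative_C_mul, derivative_X_pow]
      simp only [smul_eq_mul, mul_one, nsmul_eq_mul, map_natCast]
      rw [mul_comm (C y)]
    rw [h_mon, coeff_add, coeff_derivative, coeff_C_mul, coeff_X_pow]
    by_cases h : m = n
    · simp only [h, coeff_monomial_same, if_true, hy, mul_one, C_add]
      rw [add_comm, mul_comm]
    · rw [coeff_monomial_of_ne a (Ne.symm h), if_neg (Ne.symm h), mul_zero, add_zero, C_0, map_zero,
        zero_add, mul_comm]

end Coordinates

/-- `A` is a differential `K`-algebra without exponents nor logarithm
(i.e. `A^{∂²=0} = K` and `A^{∂+a=0} = 0` for all `a ∉ ℤ`) if and only if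
`A^{∂=0} = A[t^K]^{∂=0} = E_A^{∂=0} = K`. -/
theorem stmt_6 (K : Type) [Field K] [IsAlgClosed K] [CharZero K]
    (A : Type) [CommRing A] [Algebra K A] [Algebra (LaurentPolynomial K) A]
    [IsScalarTower K (LaurentPolynomial K) A]
    (hinj : Function.Injective (algebraMap (LaurentPolynomial K) A))
    (dA : Derivation ℤ A A) (hdA : ExtendsTddt (K := K) dA)
    (D : Derivation ℤ (EA K A) (EA K A)) (hD : DProps (K := K) dA D) :
    NoExpLog (K := K) dA ↔
      ((∀ x : A, dA x = 0 ↔ ∃ c : K, x = algebraMap K A c) ∧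
       (∀ x : AtK K A, D (Polynomial.C x) = 0 ↔ ∃ c : K, x = algebraMap K (AtK K A) c) ∧
       (∀ x : EA K A, D x = 0 ↔ ∃ c : K, x = algebraMap K (EA K A) c)) := by
  classical
  have hA : Nontrivial A := hinj.nontrivial
  have hK : Function.Injective (algebraMap K A) := (algebraMap K A).injective
  have h_const : ∀ c : K, D (algebraMap K (EA K A) c) = 0 := fun c ↦ by
    rw [algebraMap_EA, hD.1, hdA.1, map_zero]
  constructor
  · rintro ⟨h_log, h_exp⟩
    have h_ker : ∀ x : A, dA x = 0 ↔ ∃ c : K, x = algebraMap K A c := fun x ↦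
      ⟨fun h ↦ (h_log x).1 (by rw [h, map_zero]), fun ⟨c, hc⟩ ↦ by rw [hc, hdA.1]⟩
    have h_ker' : ∀ x : AtK K A, D (C x) = 0 ↔ ∃ c : K, x = algebraMap K (AtK K A) c := by
      intro x
      refine ⟨fun h ↦ ?_, fun ⟨c, hc⟩ ↦ by rw [hc]; exact h_const c⟩
      obtain ⟨y, hy, hyq⟩ := exists_derivation_C hD x
      have hy0 : y = 0 := C_injective (by rw [← hy, h, C_0])
      have hq : ∀ q, dA ((powBasis K A).repr x q) +
          exponentRep K q • (powBasis K A).repr x q = 0 := fun q ↦ by simp [← hyq, hy0]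
      obtain ⟨c, hc⟩ := (h_ker ((powBasis K A).repr x 0)).1 (by
        simpa [exponentRep_zero] using hq 0)
      refine ⟨c, (powBasis K A).repr.injective ?_⟩
      rw [algebraMap_AtK, repr_includeLeft]
      ext q
      by_cases h0 : q = 0
      · rw [h0, hc, Finsupp.single_eq_same]
      · rw [Finsupp.single_eq_of_ne h0]
        refine h_exp _ (fun hn ↦ h0 ?_) _ (hq q)
        rw [← mk_exponentRep q, mk_eq_zero_iff_exists_int]
        exact hn
    refine ⟨h_ker, h_ker', fun p ↦ ⟨fun h ↦ ?_, fun ⟨c, hc⟩ ↦ by rw [hc, h_const]⟩⟩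
    have h_coeff : ∀ n, D (C (p.coeff n)) + C (((n : AtK K A) + 1) * p.coeff (n + 1)) = 0 :=
      fun n ↦ by rw [← coeff_derivation hD, h, coeff_zero, C_0]
    have h_deg : p.natDegree = 0 := by
      by_contra hn
      obtain ⟨n, hn⟩ := Nat.exists_eq_succ_of_ne_zero hn
      have h_lead := h_coeff (n + 1)
      rw [coeff_eq_zero_of_natDegree_lt (n := n + 1 + 1) (by omega), mul_zero, C_0, add_zero,
        h_ker'] at h_lead
      obtain ⟨c, hc⟩ := h_lead
      obtain ⟨y, hy, hyq⟩ := exists_derivation_C hD (p.coeff n)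
      have hy' : y = Algebra.TensorProduct.includeLeftRingHom
          (algebraMap K A (-((n + 1) * c))) := C_injective (by
        have h_next := h_coeff n
        rw [hy, hc, algebraMap_AtK, ← C_add] at h_next
        rw [eq_neg_of_add_eq_zero_left (C_eq_zero.1 h_next)]
        simp only [map_neg, map_mul, map_add, map_natCast, map_one])
      have hz := hyq 0
      rw [hy', repr_includeLeft, Finsupp.single_eq_same, exponentRep_zero, zero_smul,
        add_zero] at hz
      obtain ⟨e, he⟩ := (h_log ((powBasis K A).repr (p.coeff n) 0)).1 (by rw [← hz, hdA.1])
      rw [he, hdA.1, map_eq_zero_iff _ hK, neg_eq_zero, mul_eq_zero] at hz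
      have hc0 : c = 0 := hz.resolve_left (by exact_mod_cast n.succ_ne_zero)
      rw [hc0, map_zero] at hc
      have hp0 : p = 0 := leadingCoeff_eq_zero.1 (by rw [leadingCoeff, hn]; exact hc)
      simp [hp0] at hn
    rw [eq_C_of_natDegree_eq_zero h_deg] at h ⊢
    obtain ⟨c, hc⟩ := (h_ker' _).1 h
    exact ⟨c, by rw [hc]; rfl⟩
  · rintro ⟨h_ker, h_ker', h_ker''⟩
    refine ⟨fun x ↦ ⟨fun h ↦ ?_, fun ⟨c, hc⟩ ↦ by rw [hc, hdA.1, map_zero]⟩, fun a ha x hx ↦ ?_⟩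
    · obtain ⟨c, hc⟩ := (h_ker _).1 h
      obtain ⟨e, he⟩ := (h_ker'' (iA K A x + algebraMap K (EA K A) (-c) * X)).1 (by
        rw [map_add, Derivation.leibniz, h_const, hD.1, hD.2.2, hc, algebraMap_EA]
        simp)
      have h1 := congrArg (fun p ↦ p.coeff 1) he
      simp only [algebraMap_EA, iA, RingHom.comp_apply, coeff_add, coeff_C_mul, coeff_X_one,
        coeff_C_succ, mul_one, zero_add] at h1
      rw [map_eq_zero_iff _ includeLeft_injective, map_eq_zero_iff _ hK] at h1
      refine ⟨e, iA_injective (K := K) ?_⟩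
      rw [← algebraMap_EA, ← he, h1, map_zero, zero_mul, add_zero]
    · have h_prod : iA K A x * tpow K A a =
          C (x ⊗ₜ[LaurentPolynomial K] (AddMonoidAlgebra.single a 1)) := by
        simp [iA, tpow, ← C_mul]
      obtain ⟨c, hc⟩ := (h_ker' (x ⊗ₜ[LaurentPolynomial K] (AddMonoidAlgebra.single a 1))).1 (by
        have hx' : dA x = -(a • x) := eq_neg_of_add_eq_zero_left hx
        rw [← h_prod, Derivation.leibniz, hD.1, hD.2.1, Algebra.smul_def a (tpow K A a),
          algebraMap_EA, hx', Algebra.smul_def a x, map_neg, map_mul]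
        simp only [smul_eq_mul]
        ring)
      obtain ⟨u, hu, hux⟩ := tmul_single_eq_smul_powBasis x a
      rw [hux, algebraMap_AtK] at hc
      have hr := DFunLike.congr_fun (congrArg (powBasis K A).repr hc)
        (a : K ⧸ (Int.castAddHom K).range)
      rw [repr_includeLeft, map_smul, Module.Basis.repr_self, Finsupp.smul_apply,
        Finsupp.single_eq_same, smul_eq_mul, mul_one,
        Finsupp.single_eq_of_ne fun h ↦ ha ((mk_eq_zero_iff_exists_int a).1 h)] at hr
      exact hu.mul_right_eq_zero.1 hr

end
end
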